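/- Let N ≥ 1, let σ be a 2N×2N Hermitian positive-definite complex matrix with positive square root σ^{1/2}, let D be a 2N×2N diagonal matrix with strictly positive real diagonal entries, and let U be a 2N×2N unitary matrix such that U† σ^{1/2} K σ^{1/2} U = K D. Then the matrix S := σ^{1/2} U D^{−1/2} satisfies σ = S D S† and S K S† = K. -/

import Mathlib

open Matrix BigOperators
open scoped ComplexOrder

noncomputable section

abbrev Idx (N : ℕ) := Fin N ⊕ Fin N

/-- The complex-form symplectic form `K = [[I, 0], [0, -I]]`. -/
def Km (N : ℕ) : Matrix (Idx N) (Idx N) ℂ := Matrix.fromBlocks 1 0 0 (-1)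

theorem Km_mul_self (N : ℕ) : Km N * Km N = 1 := by
  simp [Km, Matrix.fromBlocks_multiply]

theorem Km_eq_diagonal (N : ℕ) :
    Km N = Matrix.diagonal (Sum.elim (fun _ => 1) (fun _ => -1)) := by
  rw [← Matrix.fromBlocks_diagonal]
  simp [Km, ← Matrix.diagonal_neg]

theorem Km_mul_diagonal_comm (N : ℕ) (e : Idx N → ℂ) :
    Km N * Matrix.diagonal e = Matrix.diagonal e * Km N := by
  simp only [Km_eq_diagonal, Matrix.diagonal_mul_diagonal, mul_comm]

theorem stmt8 (N : ℕ) (hN : 1 ≤ N)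
    (σ s : Matrix (Idx N) (Idx N) ℂ) (hσ : σ.PosDef)
    (hs : s.PosDef) (hsq : s * s = σ)
    (d : Idx N → ℝ) (hd : ∀ i, 0 < d i)
    (U : Matrix (Idx N) (Idx N) ℂ) (hU : Uᴴ * U = 1)
    (hdiag : Uᴴ * (s * Km N * s) * U
      = Km N * Matrix.diagonal (fun i => (d i : ℂ))) :
    let D : Matrix (Idx N) (Idx N) ℂ := Matrix.diagonal (fun i => (d i : ℂ))
    let DinvHalf : Matrix (Idx N) (Idx N) ℂ :=
      Matrix.diagonal (fun i => ((Real.sqrt (d i))⁻¹ : ℂ))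
    let S := s * U * DinvHalf
    σ = S * D * Sᴴ ∧ S * Km N * Sᴴ = Km N := by
  intro D DinvHalf S
  have hU' : U * Uᴴ = 1 := mul_eq_one_comm.mp hU
  have hKK := Km_mul_self N
  have hne : ∀ i, ((Real.sqrt (d i) : ℝ) : ℂ) ≠ 0 := fun i =>
    Complex.ofReal_ne_zero.mpr (Real.sqrt_pos.mpr (hd i)).ne'
  have hsqrt : ∀ i, (d i : ℂ) = (Real.sqrt (d i) : ℂ) * (Real.sqrt (d i) : ℂ) := fun i => by
    rw [← Complex.ofReal_mul, Real.mul_self_sqrt (hd i).le]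
  have hEE : DinvHalf * D * DinvHalf = 1 := by
    simp only [DinvHalf, D, Matrix.diagonal_mul_diagonal]
    rw [← Matrix.diagonal_one]
    congr 1
    funext i
    have h := hne i
    rw [hsqrt i]
    field_simp
  have hDE : D * (DinvHalf * DinvHalf) = 1 := by
    rw [← hEE]
    simp only [DinvHalf, D, Matrix.diagonal_mul_diagonal]
    congr 1
    funext i
    ring
  have hKE : Km N * DinvHalf = DinvHalf * Km N := Km_mul_diagonal_comm N _
  have hKD : Km N * D = D * Km N := Km_mul_diagonal_comm N _
  have hSH : Sᴴ = DinvHalf * (Uᴴ * s) := by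
    have hE : DinvHalfᴴ = DinvHalf := by
      simp only [DinvHalf, Matrix.diagonal_conjTranspose]
      congr 1
      funext i
      simp
    simp only [S, Matrix.conjTranspose_mul, hE, hs.isHermitian.eq]
  refine ⟨?_, ?_⟩
  · calc σ = s * (U * Uᴴ) * s := by rw [hU', mul_one, hsq]
      _ = s * U * (DinvHalf * D * DinvHalf) * Uᴴ * s := by rw [hEE, mul_one]; simp only [mul_assoc]
      _ = S * D * Sᴴ := by rw [hSH]; simp only [S, mul_assoc]
  · set P := U * (DinvHalf * Km N * DinvHalf) * Uᴴ with hP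
    have hMP : s * Km N * s * P = 1 := by
      calc s * Km N * s * P
          = (U * Uᴴ) * (s * Km N * s) * U * (DinvHalf * Km N * DinvHalf) * Uᴴ := by
            rw [hU', one_mul, hP]; simp only [mul_assoc]
        _ = U * (Uᴴ * (s * Km N * s) * U) * (DinvHalf * Km N * DinvHalf) * Uᴴ := by
            simp only [mul_assoc]
        _ = U * (Km N * D * (DinvHalf * (Km N * DinvHalf))) * Uᴴ := by
            rw [hdiag]; simp only [D, mul_assoc]
        _ = U * (D * (Km N * (DinvHalf * DinvHalf)) * Km N) * Uᴴ := by
            rw [hKE, hKD]; simp only [mul_assoc]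
        _ = U * (D * (DinvHalf * DinvHalf) * (Km N * Km N)) * Uᴴ := by
            rw [← mul_assoc (Km N), hKE, mul_assoc DinvHalf, hKE]; simp only [mul_assoc]
        _ = 1 := by rw [hDE, hKK, mul_one, mul_one, hU']
    have hKP : Km N * (s * P * s) = 1 := by
      have h : s * (Km N * s * P) = 1 := by rw [← hMP]; simp only [mul_assoc]
      rw [← mul_eq_one_comm.mp h]
      simp only [mul_assoc]
    calc S * Km N * Sᴴ = s * P * s := by rw [hSH, hP]; simp only [S, mul_assoc]
      _ = Km N * (Km N * (s * P * s)) := by rw [← mul_assoc (Km N), hKK, one_mul]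
      _ = Km N := by rw [hKP, mul_one]
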